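/- The profinite group S_3 × ∏_p (ℤ_p)^p, where the product ranges over all prime numbers p and ℤ_p denotes the additive group of p-adic integers, is strongly complete, but it is neither pronilpotent nor topologically finitely generated. -/

import Mathlib

/-- A profinite group is strongly complete if every subgroup of finite index is open. -/
def StronglyComplete (G : Type*) [Group G] [TopologicalSpace G] : Prop :=
  ∀ H : Subgroup G, H.index ≠ 0 → IsOpen (H : Set G)

/-- A profinite group is pronilpotent if every continuous finite quotient of it
is nilpotent, i.e. the quotient by every open normal subgroup is nilpotent. -/
def Pronilpotent (G : Type*) [Group G] [TopologicalSpace G] : Prop :=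
  ∀ (N : Subgroup G) [N.Normal], IsOpen (N : Set G) → Group.IsNilpotent (G ⧸ N)

/-- A topological group is topologically finitely generated if some finite subset
generates a dense subgroup. -/
def TopFG (G : Type*) [Group G] [TopologicalSpace G] : Prop :=
  ∃ s : Set G, s.Finite ∧ Dense (Subgroup.closure s : Set G)

instance (p : Nat.Primes) : Fact (Nat.Prime (p : ℕ)) := ⟨p.2⟩

instance : TopologicalSpace (Equiv.Perm (Fin 3)) := ⊥

instance : DiscreteTopology (Equiv.Perm (Fin 3)) := ⟨rfl⟩

/-- A `p`-adic integer is divisible by every `p`-adic integer of at least the same norm. -/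
lemma PadicInt.exists_mul_eq_of_norm_le {p : ℕ} [Fact p.Prime] {a b : ℤ_[p]} (hb : b ≠ 0)
    (h : ‖a‖ ≤ ‖b‖) : ∃ c : ℤ_[p], b * c = a := by
  have hb' : (b : ℚ_[p]) ≠ 0 := by simpa using hb
  refine ⟨⟨(a : ℚ_[p]) / b, ?_⟩, ?_⟩
  · rw [norm_div]
    exact div_le_one_of_le₀ h (norm_nonneg _)
  · apply Subtype.ext
    change (b : ℚ_[p]) * (a / b) = a
    field_simp

/-- The elements of `ℤ_[p]` congruent to a given residue class modulo `p` form an open set. -/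
lemma PadicInt.isOpen_setOf_toZMod_eq {p : ℕ} [Fact p.Prime] (c : ZMod p) :
    IsOpen {x : ℤ_[p] | PadicInt.toZMod x = c} := by
  rw [Metric.isOpen_iff]
  intro x hx
  refine ⟨1, one_pos, fun y hy => ?_⟩
  have hmem : y - x ∈ RingHom.ker (PadicInt.toZMod : ℤ_[p] →+* ZMod p) := by
    rw [PadicInt.ker_toZMod, IsLocalRing.mem_maximalIdeal, PadicInt.mem_nonunits]
    rwa [Metric.mem_ball, dist_eq_norm] at hy
  rw [RingHom.mem_ker, map_sub, sub_eq_zero] at hmem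
  exact hmem.trans hx

/-- For `m ≠ 0`, the `m`-th powers contain a neighbourhood of the identity in a product over all
primes `p` of finite powers of `ℤ_[p]`. -/
lemma setOf_pow_mem_nhds_one {k : Nat.Primes → ℕ} {m : ℕ} (hm : m ≠ 0) :
    {a | ∃ b, b ^ m = a} ∈
      nhds (1 : ∀ p : Nat.Primes, Fin (k p) → Multiplicative ℤ_[(p : ℕ)]) := by
  have hm' (p : Nat.Primes) : (m : ℤ_[(p : ℕ)]) ≠ 0 := Nat.cast_ne_zero.mpr hm
  have hfin : {p : Nat.Primes | (p : ℕ) ∣ m}.Finite :=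
    Set.Finite.of_finite_image
      ((Set.finite_Iic m).subset fun _ ⟨_, hp, h⟩ => h ▸ Nat.le_of_dvd (Nat.pos_of_ne_zero hm) hp)
      Subtype.val_injective.injOn
  have hU : {a : ∀ p : Nat.Primes, Fin (k p) → Multiplicative ℤ_[(p : ℕ)] |
      ∀ p ∈ {p : Nat.Primes | (p : ℕ) ∣ m}, ∀ i,
        ‖(a p i).toAdd‖ < ‖(m : ℤ_[(p : ℕ)])‖} ∈ nhds 1 := by
    refine (Filter.eventually_all_finite hfin).mpr fun p _ => Filter.eventually_all.mpr fun i => ?_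
    have hc : Continuous fun a : ∀ p : Nat.Primes, Fin (k p) → Multiplicative ℤ_[(p : ℕ)] =>
        ‖(a p i).toAdd‖ :=
      continuous_norm.comp (continuous_toAdd.comp
        ((continuous_apply i).comp (continuous_apply p)))
    exact (isOpen_lt hc continuous_const).mem_nhds (by simpa using hm)
  filter_upwards [hU] with a ha
  have hdiv (p : Nat.Primes) (i : Fin (k p)) :
      ∃ c : ℤ_[(p : ℕ)], (m : ℤ_[(p : ℕ)]) * c = (a p i).toAdd := by
    apply PadicInt.exists_mul_eq_of_norm_le (hm' p)
    by_cases hp : (p : ℕ) ∣ m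
    · exact (ha p hp i).le
    · have h1 : ‖(m : ℤ_[(p : ℕ)])‖ = 1 := by
        refine le_antisymm (PadicInt.norm_le_one _) (not_lt.mp fun h => hp ?_)
        exact (PadicInt.norm_natCast_lt_one_iff).mp h
      exact h1 ▸ PadicInt.norm_le_one _
  choose c hc using hdiv
  refine ⟨fun p i => Multiplicative.ofAdd (c p i), ?_⟩
  funext p i
  apply Multiplicative.toAdd.injective
  simpa using hc p i

/-- A product of a discrete group and a group whose `m`-th powers contain a neighbourhood of the
identity for all `m ≠ 0` is strongly complete. -/
lemma StronglyComplete.prod_of_setOf_pow_mem_nhds_one {F A : Type*} [Group F] [TopologicalSpace F]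
    [DiscreteTopology F] [Group A] [TopologicalSpace A] [ContinuousMul A]
    (hA : ∀ m : ℕ, m ≠ 0 → {a : A | ∃ b, b ^ m = a} ∈ nhds 1) : StronglyComplete (F × A) := by
  intro H hH
  refine H.isOpen_of_mem_nhds (g := 1) ?_
  have hF : ({1} : Set F) ∈ nhds 1 := (isOpen_discrete _).mem_nhds rfl
  refine Filter.mem_of_superset
    (prod_mem_nhds (x := (1 : F)) (y := (1 : A)) hF (hA _ (Nat.factorial_ne_zero H.index))) ?_
  rintro ⟨_, _⟩ ⟨rfl, b, rfl⟩
  have h := H.pow_mem_of_index_ne_zero_of_dvd hH ((1 : F), b) (n := H.index.factorial)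
    fun _ hpos hle => Nat.dvd_factorial hpos hle
  simpa using h

lemma Equiv.Perm.not_isNilpotent_fin_three : ¬ Group.IsNilpotent (Equiv.Perm (Fin 3)) := by
  intro h
  refine Group.IsNilpotent.center_ne_bot (G := Equiv.Perm (Fin 3)) ?_
  rw [Subgroup.eq_bot_iff_forall]
  intro σ hσ
  rw [Subgroup.mem_center_iff] at hσ
  revert σ
  decide

/-- A product with a non-nilpotent discrete factor is not pronilpotent. -/
lemma not_pronilpotent_prod {F A : Type*} [Group F] [TopologicalSpace F] [DiscreteTopology F]
    [Group A] [TopologicalSpace A] (hF : ¬ Group.IsNilpotent F) : ¬ Pronilpotent (F × A) := by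
  intro h
  have hopen : IsOpen ((MonoidHom.fst F A).ker : Set (F × A)) :=
    (isOpen_discrete ({1} : Set F)).preimage continuous_fst
  have := h _ hopen
  exact hF (Group.nilpotent_of_mulEquiv
    (QuotientGroup.quotientKerEquivOfSurjective (MonoidHom.fst F A) Prod.fst_surjective))

/-- A finite set generating a dense subgroup has at least `n` elements if the group maps onto the
`n`-dimensional vector space over a prime field with open fibres. -/
lemma le_ncard_of_dense_closure {G : Type*} [Group G] [TopologicalSpace G] {p n : ℕ}
    [Fact p.Prime] (f : G →* Multiplicative (Fin n → ZMod p)) (hf : Function.Surjective f)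
    (hopen : ∀ v, IsOpen (f ⁻¹' {v})) {s : Set G} (hs : s.Finite)
    (hd : Dense (Subgroup.closure s : Set G)) : n ≤ s.ncard := by
  let g : G → Fin n → ZMod p := fun x => (f x).toAdd
  let W : Submodule (ZMod p) (Fin n → ZMod p) := Submodule.span (ZMod p) (g '' s)
  have hle : Subgroup.closure s ≤ (AddSubgroup.toSubgroup W.toAddSubgroup).comap f :=
    (Subgroup.closure_le _).mpr fun x hx => Submodule.subset_span ⟨x, hx, rfl⟩
  have htop : W = ⊤ := by
    refine Submodule.eq_top_iff'.mpr fun v => ?_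
    obtain ⟨y, hy⟩ := hf (Multiplicative.ofAdd v)
    obtain ⟨x, hxv, hx⟩ := hd.inter_open_nonempty _ (hopen (Multiplicative.ofAdd v)) ⟨y, hy⟩
    have hxW : g x ∈ W := hle hx
    have hgx : g x = v := congrArg Multiplicative.toAdd hxv
    exact hgx ▸ hxW
  have hfin : (g '' s).Finite := hs.image g
  have := hfin.fintype
  calc n = Module.finrank (ZMod p) W := by rw [htop, finrank_top, Module.finrank_fin_fun]
    _ ≤ (g '' s).toFinset.card := finrank_span_le_card _
    _ = (g '' s).ncard := (Set.ncard_eq_toFinset_card' _).symm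
    _ ≤ s.ncard := Set.ncard_image_le hs

/-- Reduction modulo `p` of the factor of `F × ∏_p ℤ_p^{k(p)}` at the prime `p`. -/
noncomputable def reductionAt (F : Type*) [Group F] (k : Nat.Primes → ℕ) (p : Nat.Primes) :
    (F × ∀ p : Nat.Primes, Fin (k p) → Multiplicative ℤ_[(p : ℕ)]) →*
      Multiplicative (Fin (k p) → ZMod (p : ℕ)) where
  toFun x := Multiplicative.ofAdd fun i => PadicInt.toZMod (x.2 p i).toAdd
  map_one' := by
    apply Multiplicative.toAdd.injective
    funext i
    simp
  map_mul' x y := by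
    apply Multiplicative.toAdd.injective
    funext i
    simp

lemma reductionAt_surjective (F : Type*) [Group F] (k : Nat.Primes → ℕ) (p : Nat.Primes) :
    Function.Surjective (reductionAt F k p) := by
  intro v
  choose c hc using fun i : Fin (k p) =>
    ZMod.ringHom_surjective (PadicInt.toZMod (p := (p : ℕ))) (v.toAdd i)
  classical
  refine ⟨(1, Pi.mulSingle p fun i => Multiplicative.ofAdd (c i)), ?_⟩
  apply Multiplicative.toAdd.injective
  funext i
  simpa [reductionAt] using hc i

lemma isOpen_reductionAt_fiber (F : Type*) [Group F] [TopologicalSpace F] (k : Nat.Primes → ℕ)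
    (p : Nat.Primes) (v : Multiplicative (Fin (k p) → ZMod (p : ℕ))) :
    IsOpen (reductionAt F k p ⁻¹' {v}) := by
  have heq : reductionAt F k p ⁻¹' {v} =
      ⋂ i, (fun x => (x.2 p i).toAdd) ⁻¹' {z : ℤ_[(p : ℕ)] | PadicInt.toZMod z = v.toAdd i} := by
    ext x
    rw [Set.mem_iInter]
    exact funext_iff (f := (reductionAt F k p x).toAdd) (g := v.toAdd)
  rw [heq]
  exact isOpen_iInter_of_finite fun i => (PadicInt.isOpen_setOf_toZMod_eq _).preimage
    (continuous_toAdd.comp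
      ((continuous_apply i).comp ((continuous_apply p).comp continuous_snd)))

/-- If the ranks `k p` are unbounded, then `F × ∏_p ℤ_p^{k(p)}` is not topologically finitely
generated. -/
lemma not_topFG_prod_padicInt (F : Type*) [Group F] [TopologicalSpace F] {k : Nat.Primes → ℕ}
    (hk : ∀ n, ∃ p, n < k p) :
    ¬ TopFG (F × ∀ p : Nat.Primes, Fin (k p) → Multiplicative ℤ_[(p : ℕ)]) := by
  rintro ⟨s, hs, hd⟩
  obtain ⟨p, hp⟩ := hk s.ncard
  exact hp.not_ge (le_ncard_of_dense_closure (reductionAt F k p) (reductionAt_surjective F k p)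
    (isOpen_reductionAt_fiber F k p) hs hd)

/-- The profinite group `S₃ × ∏_p ℤ_p^p` (the product over all primes `p` of `p`
copies of the additive group of `p`-adic integers, times the symmetric group on
three letters) is strongly complete, but neither pronilpotent nor topologically
finitely generated. -/
theorem s3_prod_padic_stronglyComplete :
    StronglyComplete (Equiv.Perm (Fin 3) ×
        ∀ p : Nat.Primes, Fin (p : ℕ) → Multiplicative ℤ_[(p : ℕ)]) ∧
      ¬ Pronilpotent (Equiv.Perm (Fin 3) ×
        ∀ p : Nat.Primes, Fin (p : ℕ) → Multiplicative ℤ_[(p : ℕ)]) ∧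
      ¬ TopFG (Equiv.Perm (Fin 3) ×
        ∀ p : Nat.Primes, Fin (p : ℕ) → Multiplicative ℤ_[(p : ℕ)]) := by
  refine ⟨StronglyComplete.prod_of_setOf_pow_mem_nhds_one fun m hm => setOf_pow_mem_nhds_one hm,
    not_pronilpotent_prod Equiv.Perm.not_isNilpotent_fin_three,
    not_topFG_prod_padicInt _ fun n => ?_⟩
  obtain ⟨p, hle, hp⟩ := Nat.exists_infinite_primes (n + 1)
  exact ⟨⟨p, hp⟩, hle⟩
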